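/- arXiv:1404.1489 — 6 statements merged into one kernel-verified Lean document; each statement's English description precedes it below -/
import Mathlib

section
/- For integers n ≥ 3 and 1 ≤ k ≤ n, and real t > 0, define x_k(t) = t·(log t)^{k-1}. Then for every integer r ≥ 2 and every 1 ≤ k ≤ n-1, the r-th derivative of x_{k+1} satisfies x_{k+1}^{(r)}(t) = k · Σ_{j=1}^{r-1} [(-1)^{j+1} (j-1)! · binom(r-2, j-1) / t^j] · x_k^{(r-j)}(t). -/
open Real Finset

/-- `xfun k t = t * (log t)^(k-1)`, the `k`-th component function of the curve. -/
noncomputable def xfun (k : ℕ) : ℝ → ℝ := fun t => t * (Real.log t) ^ (k - 1)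

open Filter Topology

theorem hasDerivAt_xfun (k : ℕ) {t : ℝ} (ht : t ≠ 0) :
    HasDerivAt (xfun k)
      (log t ^ (k - 1) + ((k - 1 : ℕ) : ℝ) * log t ^ (k - 1 - 1)) t := by
  refine ((hasDerivAt_id t).mul ((hasDerivAt_log ht).pow (k - 1))).congr_deriv ?_
  simp only [id, Pi.pow_apply]
  field_simp

theorem deriv_deriv_xfun_succ (k : ℕ) {t : ℝ} (ht : t ≠ 0) :
    deriv (deriv (xfun (k + 1))) t = (k : ℝ) * (t⁻¹ * deriv (xfun k) t) := by
  have h : deriv (xfun (k + 1)) =ᶠ[𝓝 t] fun s => log s ^ k + (k : ℝ) * log s ^ (k - 1) := by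
    filter_upwards [isOpen_ne.mem_nhds ht] with s hs
    simpa using (hasDerivAt_xfun (k + 1) hs).deriv
  rw [h.deriv_eq, (hasDerivAt_xfun k ht).deriv]
  have h2 := ((hasDerivAt_log ht).pow k).add
    (((hasDerivAt_log ht).pow (k - 1)).const_mul (k : ℝ))
  refine h2.deriv.trans ?_
  ring

theorem analyticAt_xfun (k : ℕ) {t : ℝ} (ht : 0 < t) : AnalyticAt ℝ (xfun k) t :=
  analyticAt_id.mul ((analyticAt_log ht).pow (k - 1))

theorem stmt_0 (n : ℕ) (hn : 3 ≤ n) (k : ℕ) (hk1 : 1 ≤ k) (hk2 : k ≤ n - 1)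
    (r : ℕ) (hr : 2 ≤ r) (t : ℝ) (ht : 0 < t) :
    iteratedDeriv r (xfun (k + 1)) t =
      (k : ℝ) * ∑ j ∈ Finset.Icc 1 (r - 1),
        ((-1 : ℝ) ^ (j + 1) * (Nat.factorial (j - 1) : ℝ) * ((r - 2).choose (j - 1) : ℝ) / t ^ j) *
          iteratedDeriv (r - j) (xfun k) t := by
  obtain ⟨m, rfl⟩ := Nat.exists_eq_add_of_le' hr
  have h : deriv (deriv (xfun (k + 1))) =ᶠ[𝓝 t]
      fun s => (k : ℝ) * (s⁻¹ * deriv (xfun k) s) := by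
    filter_upwards [isOpen_ne.mem_nhds ht.ne'] with s hs
    exact deriv_deriv_xfun_succ k hs
  rw [iteratedDeriv_succ', iteratedDeriv_succ', h.iteratedDeriv_eq,
    iteratedDeriv_const_mul_field,
    iteratedDeriv_fun_mul (contDiffAt_inv ℝ ht.ne') (analyticAt_xfun k ht).deriv.contDiffAt]
  congr 1
  rw [← Finset.Ico_add_one_right_eq_Icc, Finset.sum_Ico_eq_sum_range]
  refine Finset.sum_congr (by simp) fun i hi => ?_
  have him : i ≤ m := Nat.lt_succ_iff.mp (Finset.mem_range.mp hi)
  have hinv : iteratedDeriv i (fun s : ℝ => s⁻¹) t = (-1) ^ i * i.factorial / t ^ (i + 1) := by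
    rw [iteratedDeriv_eq_iterate]
    refine (iter_deriv_inv i t).trans ?_
    rw [show (-1 - i : ℤ) = -((i + 1 : ℕ) : ℤ) by push_cast; ring, zpow_neg, zpow_natCast,
      div_eq_mul_inv]
  rw [hinv, ← iteratedDeriv_succ', show m + 2 - (1 + i) = m - i + 1 by omega,
    Nat.add_sub_cancel_left, Nat.add_sub_cancel]
  ring
end

section
/- For every integer n ≥ 2 and every real number x, Σ_{k=2}^{n} [ (-1)^{k-1} · (1/(k-2)!) · Σ_{j=0}^{n-k} x^{n-j-2}/(n-k-j)! ] = -1. -/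
open Finset

theorem sum_range_neg_one_pow_div_factorial_mul_factorial (s : ℕ) :
    ∑ k ∈ range (s + 1), (-1 : ℝ) ^ k / ((k.factorial : ℝ) * ((s - k).factorial : ℝ)) =
      if s = 0 then 1 else 0 := by
  have h : ∑ k ∈ range (s + 1), (-1 : ℝ) ^ k * (s.choose k : ℝ) = if s = 0 then 1 else 0 := by
    exact_mod_cast Int.alternating_sum_range_choose (n := s)
  calc
    _ = (∑ k ∈ range (s + 1), (-1 : ℝ) ^ k * (s.choose k : ℝ)) / (s.factorial : ℝ) := by
      rw [sum_div]
      refine sum_congr rfl fun k hk => ?_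
      rw [Nat.cast_choose ℝ (Nat.lt_succ_iff.mp (mem_range.mp hk))]
      have hs := Nat.cast_ne_zero (R := ℝ).mpr s.factorial_ne_zero
      field_simp
    _ = _ := by
      rw [h]
      split_ifs with hs <;> simp [hs]

theorem sum_range_neg_one_pow_mul_truncated_exp (m : ℕ) (x : ℝ) :
    ∑ p ∈ range (m + 1), ∑ i ∈ range (m + 1 - p),
      (-1 : ℝ) ^ p * x ^ (p + i) / ((p.factorial : ℝ) * (i.factorial : ℝ)) = 1 := by
  rw [← sum_range_diag_flip (m + 1)
    fun p i => (-1 : ℝ) ^ p * x ^ (p + i) / ((p.factorial : ℝ) * (i.factorial : ℝ))]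
  calc
    _ = ∑ s ∈ range (m + 1), x ^ s * if s = 0 then 1 else 0 := by
      refine sum_congr rfl fun s _ => ?_
      rw [← sum_range_neg_one_pow_div_factorial_mul_factorial, mul_sum]
      refine sum_congr rfl fun k hk => ?_
      rw [Nat.add_sub_of_le (Nat.lt_succ_iff.mp (mem_range.mp hk))]
      ring
    _ = 1 := by simp

theorem stmt_5 (n : ℕ) (hn : 2 ≤ n) (x : ℝ) :
    ∑ k ∈ Finset.Icc 2 n,
        ((-1 : ℝ) ^ (k - 1) * (1 / (Nat.factorial (k - 2) : ℝ)) *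
          ∑ j ∈ Finset.range (n - k + 1), x ^ (n - j - 2) / (Nat.factorial (n - k - j) : ℝ)) =
      -1 := by
  obtain ⟨m, rfl⟩ := Nat.exists_eq_add_of_le' hn
  refine Eq.trans ?_ (congrArg Neg.neg (sum_range_neg_one_pow_mul_truncated_exp m x))
  rw [← sum_neg_distrib, ← Ico_add_one_right_eq_Icc, sum_Ico_eq_sum_range]
  refine sum_congr (by congr 1) fun p hp => ?_
  have hpm : p < m + 1 := by rw [mem_range] at hp; lia
  rw [← sum_range_reflect _ (m + 2 - (2 + p) + 1), mul_sum, ← sum_neg_distrib]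
  refine sum_congr (by congr 1; lia) fun i hi => ?_
  rw [mem_range] at hi
  rw [show m + 2 - (m + 2 - (2 + p) + 1 - 1 - i) - 2 = p + i by lia,
    show m + 2 - (2 + p) - (m + 2 - (2 + p) + 1 - 1 - i) = i by lia,
    show 2 + p - 1 = p + 1 by lia, show 2 + p - 2 = p by lia, pow_succ]
  ring
end

section
/- For integers n ≥ 3 and real t > 0, Σ_{k=1}^{n} (-1)^{k-1} · x_k(t) · v_{k,n}(t) = (Π_{r=0}^{n-1} r!) / t^{n(n-3)/2}, where x_k(t) = t·(log t)^{k-1}. -/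
open Real Finset

/-- `v n k t = (∏_{r=0}^{n-1} r!)/(k-1)! · t^{-(n-2)(n-1)/2} · ∑_{j=0}^{n-k} (log t)^{n-k-j}/(n-k-j)!`. -/
noncomputable def v (n k : ℕ) (t : ℝ) : ℝ :=
  ((∏ r ∈ Finset.range n, (Nat.factorial r : ℝ)) / (Nat.factorial (k - 1) : ℝ)) *
    (1 / t ^ ((n - 2) * (n - 1) / 2)) *
    ∑ j ∈ Finset.range (n - k + 1), (Real.log t) ^ (n - k - j) / (Nat.factorial (n - k - j) : ℝ)

/-- Coefficient of degree `n` in `exp (-L) * exp L`. -/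
theorem sum_neg_pow_div_factorial_mul_pow_div_factorial (L : ℝ) (n : ℕ) (hn : n ≠ 0) :
    ∑ i ∈ Finset.range (n + 1), (-L) ^ i / (Nat.factorial i : ℝ) *
      (L ^ (n - i) / (Nat.factorial (n - i) : ℝ)) = 0 := by
  have h := add_pow (-L) L n
  rw [neg_add_cancel, zero_pow hn] at h
  have hf (m : ℕ) : (Nat.factorial m : ℝ) ≠ 0 := by positivity
  apply mul_left_cancel₀ (hf n)
  rw [mul_zero, h, Finset.mul_sum]
  refine Finset.sum_congr rfl fun i hi => ?_
  rw [Nat.cast_choose ℝ (Finset.mem_range_succ_iff.mp hi)]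
  have h₁ := hf i
  have h₂ := hf (n - i)
  field_simp

/-- The truncation of `exp (-L) * exp L = 1` to total degree at most `n`. -/
theorem sum_neg_pow_div_factorial_mul_sum_pow_div_factorial (L : ℝ) (n : ℕ) :
    ∑ i ∈ Finset.range (n + 1), (-L) ^ i / (Nat.factorial i : ℝ) *
      ∑ m ∈ Finset.range (n - i + 1), L ^ m / (Nat.factorial m : ℝ) = 1 := by
  induction n with
  | zero => simp
  | succ n ih =>
    have h := sum_neg_pow_div_factorial_mul_pow_div_factorial L (n + 1) n.succ_ne_zero
    have split : ∀ i ∈ Finset.range (n + 1 + 1), (-L) ^ i / (Nat.factorial i : ℝ) *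
        ∑ m ∈ Finset.range (n + 1 - i + 1), L ^ m / (Nat.factorial m : ℝ) =
        (-L) ^ i / (Nat.factorial i : ℝ) *
          ∑ m ∈ Finset.range (n + 1 - i), L ^ m / (Nat.factorial m : ℝ) +
        (-L) ^ i / (Nat.factorial i : ℝ) *
          (L ^ (n + 1 - i) / (Nat.factorial (n + 1 - i) : ℝ)) := fun i _ => by
      rw [Finset.sum_range_succ, mul_add]
    rw [Finset.sum_congr rfl split, Finset.sum_add_distrib, h, add_zero, Finset.sum_range_succ,
      Nat.sub_self, Finset.sum_range_zero, mul_zero, add_zero, ← ih]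
    refine Finset.sum_congr rfl fun i hi => ?_
    rw [Nat.sub_add_comm (Finset.mem_range_succ_iff.mp hi)]

theorem stmt_8 (n : ℕ) (hn : 3 ≤ n) (t : ℝ) (ht : 0 < t) :
    ∑ k ∈ Finset.Icc 1 n, (-1 : ℝ) ^ (k - 1) * xfun k t * v n k t =
      (∏ r ∈ Finset.range n, (Nat.factorial r : ℝ)) / t ^ (n * (n - 3) / 2) := by
  obtain ⟨m, rfl⟩ := Nat.exists_eq_add_of_le' hn
  have hexp : (m + 3 - 2) * (m + 3 - 1) / 2 = (m + 3) * (m + 3 - 3) / 2 + 1 := by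
    have : (m + 3 - 2) * (m + 3 - 1) = (m + 3) * (m + 3 - 3) + 2 := by
      simp only [Nat.add_sub_cancel, show m + 3 - 2 = m + 1 by lia, show m + 3 - 1 = m + 2 by lia]
      ring
    lia
  have hsum := sum_neg_pow_div_factorial_mul_sum_pow_div_factorial (Real.log t) (m + 2)
  conv_rhs => rw [← mul_one (_ / _), ← hsum, Finset.mul_sum]
  rw [← Finset.Ico_add_one_right_eq_Icc,
    Finset.sum_Ico_eq_sum_range]
  refine Finset.sum_congr rfl fun i _ => ?_
  have hreflect : ∑ j ∈ Finset.range (m + 3 - (1 + i) + 1),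
      Real.log t ^ (m + 3 - (1 + i) - j) / (Nat.factorial (m + 3 - (1 + i) - j) : ℝ) =
      ∑ j ∈ Finset.range (m + 2 - i + 1), Real.log t ^ j / (Nat.factorial j : ℝ) := by
    rw [show m + 3 - (1 + i) = m + 2 - i by lia]
    exact Finset.sum_range_reflect
      (fun j => Real.log t ^ j / (Nat.factorial j : ℝ)) (m + 2 - i + 1)
  rw [v, xfun, hreflect, hexp, Nat.add_sub_cancel_left, neg_pow (Real.log t), pow_succ]
  field_simp
end

section
/- For integers n ≥ 3, every integer j with 1 ≤ j ≤ n-1, and real t > 0, Σ_{k=1}^{n} (-1)^{k-1} · x_k^{(j)}(t) · v_{k,n}(t) = 0, where x_k(t) = t·(log t)^{k-1} and x_k^{(j)} denotes its j-th derivative. -/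
open Real Finset

theorem sum_range_mul_sum_range_div_factorial (n : ℕ) (a b : ℝ) :
    ∑ m ∈ range n, b ^ m / (Nat.factorial m : ℝ) *
        ∑ i ∈ range (n - m), a ^ i / (Nat.factorial i : ℝ) =
      ∑ p ∈ range n, (b + a) ^ p / (Nat.factorial p : ℝ) := by
  simp_rw [mul_sum]
  rw [← sum_range_diag_flip n
    fun m i => b ^ m / (Nat.factorial m : ℝ) * (a ^ i / (Nat.factorial i : ℝ))]
  refine sum_congr rfl fun p _ => ?_
  rw [add_pow, sum_div]
  refine sum_congr rfl fun m hm => ?_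
  rw [Nat.cast_choose ℝ (Nat.lt_succ_iff.mp (mem_range.mp hm))]
  field_simp

theorem hasDerivAt_mul_sum_sub_log_pow (N : ℕ) (a : ℝ) {s : ℝ} (hs : s ≠ 0) :
    HasDerivAt
      (fun s => s * ∑ p ∈ range (N + 1), (a - Real.log s) ^ p / (Nat.factorial p : ℝ))
      ((a - Real.log s) ^ N / (Nat.factorial N : ℝ)) s := by
  have hlog : HasDerivAt (fun s => a - Real.log s) (-s⁻¹) s :=
    (Real.hasDerivAt_log hs).const_sub a
  induction N with
  | zero => simpa using hasDerivAt_id' s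
  | succ N ih =>
    have hterm := (hasDerivAt_id s).mul
      ((hlog.pow (N + 1)).div_const (Nat.factorial (N + 1) : ℝ))
    refine ((ih.add hterm).congr_of_eventuallyEq (.of_forall fun x => ?_)).congr_deriv ?_
    · simp [sum_range_succ _ (N + 1), mul_add]
    · simp only [id, Nat.factorial_succ, Nat.add_sub_cancel]
      push_cast
      field_simp
      simp only [Pi.pow_apply]
      ring

theorem iteratedDeriv_sub_log_pow_eq_zero {i N : ℕ} (hi : i < N) {t : ℝ} (ht : 0 < t) (c : ℝ) :
    iteratedDeriv i (fun s => (Real.log t - Real.log s) ^ N / c) t = 0 := by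
  have hg : AnalyticAt ℝ (fun s => Real.log t - Real.log s) t :=
    analyticAt_const.sub (analyticAt_log ht)
  have h1 : 1 ≤ analyticOrderAt (fun s => Real.log t - Real.log s) t :=
    Order.one_le_iff_ne_zero.mpr (hg.analyticOrderAt_ne_zero.mpr (sub_self _))
  have hpow : (N : ℕ∞) ≤ analyticOrderAt ((fun s => Real.log t - Real.log s) ^ N) t := by
    rw [analyticOrderAt_pow hg, nsmul_eq_mul]
    exact le_mul_of_one_le_right' h1
  have h0 := (natCast_le_analyticOrderAt_iff_iteratedDeriv_eq_zero (hg.pow N)).mp hpow i hi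
  have h := iteratedDeriv_const_mul_field (n := i) (x := t) c⁻¹
    ((fun s => Real.log t - Real.log s) ^ N)
  rw [h0, mul_zero] at h
  simpa only [Pi.pow_apply, div_eq_inv_mul] using h

theorem contDiffAt_xfun (k j : ℕ) {t : ℝ} (ht : t ≠ 0) : ContDiffAt ℝ j (xfun k) t :=
  contDiffAt_id.mul ((Real.contDiffAt_log.mpr ht).pow _)

theorem v_succ (n m : ℕ) (t : ℝ) (hm : m < n) :
    v n (m + 1) t =
      ((∏ r ∈ range n, (Nat.factorial r : ℝ)) * (1 / t ^ ((n - 2) * (n - 1) / 2))) *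
        ((∑ i ∈ range (n - m), Real.log t ^ i / (Nat.factorial i : ℝ)) /
          (Nat.factorial m : ℝ)) := by
  have h : n - (m + 1) + 1 = n - m := by omega
  have hr := sum_range_reflect (fun i => Real.log t ^ i / (Nat.factorial i : ℝ)) (n - m)
  simp only [Nat.sub_sub] at hr
  simp only [v, h, Nat.add_sub_cancel, Nat.sub_sub, hr]
  ring

theorem stmt_9 (n : ℕ) (hn : 3 ≤ n) (j : ℕ) (hj1 : 1 ≤ j) (hj2 : j ≤ n - 1)
    (t : ℝ) (ht : 0 < t) :
    ∑ k ∈ Finset.Icc 1 n, (-1 : ℝ) ^ (k - 1) * iteratedDeriv j (xfun k) t * v n k t = 0 := by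
  set c : ℕ → ℝ := fun m => (-1) ^ m *
    ((∑ i ∈ range (n - m), Real.log t ^ i / (Nat.factorial i : ℝ)) / (Nat.factorial m : ℝ)) with hc
  have hF : (fun s => ∑ m ∈ range n, c m * xfun (m + 1) s) =
      fun s => s * ∑ p ∈ range (n - 1 + 1),
        (Real.log t - Real.log s) ^ p / (Nat.factorial p : ℝ) := by
    funext s
    rw [Nat.sub_add_cancel (by omega), ← neg_add_eq_sub,
      ← sum_range_mul_sum_range_div_factorial, mul_sum]
    refine sum_congr rfl fun m _ => ?_
    rw [neg_pow]
    simp only [hc, xfun, Nat.add_sub_cancel]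
    ring
  have hzero : iteratedDeriv j (fun s => ∑ m ∈ range n, c m * xfun (m + 1) s) t = 0 := by
    obtain ⟨i, rfl⟩ := Nat.exists_eq_add_of_le' hj1
    rw [hF, iteratedDeriv_succ']
    refine Eq.trans (Filter.EventuallyEq.iteratedDeriv_eq i ?_)
      (iteratedDeriv_sub_log_pow_eq_zero (N := n - 1) (by omega) ht (Nat.factorial (n - 1)))
    filter_upwards [eventually_ne_nhds ht.ne'] with s hs
    exact (hasDerivAt_mul_sum_sub_log_pow (n - 1) (Real.log t) hs).deriv
  rw [iteratedDeriv_fun_sum fun m _ => contDiffAt_const.mul (contDiffAt_xfun _ j ht.ne')] at hzero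
  simp only [iteratedDeriv_const_mul_field] at hzero
  rw [← Finset.Ico_add_one_right_eq_Icc, sum_Ico_eq_sum_range, Nat.add_sub_cancel]
  refine Eq.trans ?_ ((congrArg (((∏ r ∈ range n, (Nat.factorial r : ℝ)) *
    (1 / t ^ ((n - 2) * (n - 1) / 2))) * ·) hzero).trans (mul_zero _))
  rw [mul_sum]
  refine sum_congr rfl fun m hm => ?_
  rw [add_comm 1 m, v_succ n m t (mem_range.mp hm), Nat.add_sub_cancel]
  simp only [hc]
  ring
end

section
/- For integers n ≥ 3 and real t > 0, the Wronskian of the n functions x_1, ..., x_n, where x_k(t) = t·(log t)^{k-1}, equals (Π_{r=0}^{n-1} r!) / t^{n(n-3)/2}. That is, the determinant of the n×n matrix whose (i,k) entry is the (i-1)-st derivative of x_k at t (for 1 ≤ i,k ≤ n) equals (Π_{r=0}^{n-1} r!) / t^{n(n-3)/2}. -/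
open Real Finset

open Polynomial in
/-- The polynomial `∏ r < i, (X + 1 - r)`. In terms of `L = log t`, the operator
`t ^ i * (d / dt) ^ i` acts on `t * q L` as this polynomial in `d / dL` acts on `q`. -/
noncomputable def eulerPoly (i : ℕ) : ℝ[X] := ∏ r ∈ Finset.range i, (X + C (1 - (r : ℝ)))

open Polynomial in
theorem eulerPoly_succ (i : ℕ) : eulerPoly (i + 1) = (X + C (1 - (i : ℝ))) * eulerPoly i := by
  rw [eulerPoly, Finset.prod_range_succ, mul_comm, eulerPoly]

theorem monic_eulerPoly (i : ℕ) : (eulerPoly i).Monic :=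
  Polynomial.monic_prod_of_monic _ _ fun _ _ => Polynomial.monic_X_add_C _

theorem natDegree_eulerPoly (i : ℕ) : (eulerPoly i).natDegree = i := by
  rw [eulerPoly, Polynomial.natDegree_prod_of_monic _ _ fun _ _ => Polynomial.monic_X_add_C _]
  simp only [Polynomial.natDegree_X_add_C, Finset.sum_const, Finset.card_range, smul_eq_mul,
    mul_one]

open Polynomial in
theorem iteratedDeriv_mul_eval_log (q : ℝ[X]) (i : ℕ) {t : ℝ} (ht : 0 < t) :
    iteratedDeriv i (fun s => s * q.eval (Real.log s)) t =
      t ^ (1 - (i : ℤ)) *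
        (aeval (derivative : Module.End ℝ ℝ[X]) (eulerPoly i) q).eval (Real.log t) := by
  induction i generalizing t with
  | zero => simp [eulerPoly]
  | succ i ih =>
    rw [iteratedDeriv_succ]
    set p := aeval (derivative : Module.End ℝ ℝ[X]) (eulerPoly i) q with hp
    have hev : iteratedDeriv i (fun s => s * q.eval (Real.log s)) =ᶠ[nhds t]
        fun s => s ^ (1 - (i : ℤ)) * p.eval (Real.log s) := by
      filter_upwards [lt_mem_nhds ht] with s hs using ih hs
    have hd := (hasDerivAt_zpow (1 - (i : ℤ)) t (Or.inl ht.ne')).mul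
      ((p.hasDerivAt (Real.log t)).comp t (Real.hasDerivAt_log ht.ne'))
    have hsucc : aeval (derivative : Module.End ℝ ℝ[X]) (eulerPoly (i + 1)) q =
        derivative p + (1 - (i : ℝ)) • p := by
      rw [eulerPoly_succ, map_mul, Module.End.mul_apply, ← hp, map_add, aeval_X, aeval_C,
        LinearMap.add_apply, Module.algebraMap_end_apply]
    rw [hev.deriv_eq, hsucc]
    refine hd.deriv.trans ?_
    have h1 : (1 - ((i + 1 : ℕ) : ℤ)) = 1 - (i : ℤ) - 1 := by push_cast; ring
    rw [h1, eval_add, eval_smul, zpow_sub_one₀ ht.ne']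
    simp only [Function.comp_apply, smul_eq_mul]
    push_cast
    ring

theorem prod_zpow_one_sub {t : ℝ} (ht : t ≠ 0) (m : ℕ) :
    ∏ i ∈ Finset.range (m + 3), t ^ (1 - (i : ℤ)) = (t ^ ((m + 3) * m / 2))⁻¹ := by
  induction m with
  | zero => simp [Finset.prod_range_succ, ht]
  | succ m ih =>
    have h : (m + 1 + 3) * (m + 1) / 2 = (m + 3) * m / 2 + (m + 2) := by
      rw [show (m + 1 + 3) * (m + 1) = (m + 3) * m + (m + 2) * 2 by ring]
      exact Nat.add_mul_div_right _ _ two_pos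
    rw [show m + 1 + 3 = (m + 3) + 1 by ring, Finset.prod_range_succ, ih,
      show m + 3 + 1 = m + 1 + 3 by ring, h, pow_add, mul_inv]
    congr 1

open Polynomial in
theorem eval_iterate_derivative_X_pow (j k : ℕ) (x : ℝ) :
    (((derivative : Module.End ℝ ℝ[X]) ^ j) (X ^ k)).eval x =
      (k.descFactorial j : ℝ) * x ^ (k - j) := by
  rw [Module.End.pow_apply, iterate_derivative_X_pow_eq_natCast_mul]
  simp

theorem stmt_10 (n : ℕ) (hn : 3 ≤ n) (t : ℝ) (ht : 0 < t) :
    (Matrix.of fun i k : Fin n => iteratedDeriv (i : ℕ) (xfun ((k : ℕ) + 1)) t).det =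
      (∏ r ∈ Finset.range n, (Nat.factorial r : ℝ)) / t ^ (n * (n - 3) / 2) := by
  set A : Matrix (Fin n) (Fin n) ℝ := Matrix.of fun i j => (eulerPoly i).coeff j with hA
  set B : Matrix (Fin n) (Fin n) ℝ := Matrix.of fun j k =>
    ((k : ℕ).descFactorial j : ℝ) * Real.log t ^ ((k : ℕ) - j) with hB
  have hfactor : (Matrix.of fun i k : Fin n => iteratedDeriv (i : ℕ) (xfun ((k : ℕ) + 1)) t) =
      Matrix.diagonal (fun i : Fin n => t ^ (1 - ((i : ℕ) : ℤ))) * (A * B) := by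
    ext i k
    have hx : xfun ((k : ℕ) + 1) =
        fun s => s * (Polynomial.X ^ (k : ℕ) : Polynomial ℝ).eval (Real.log s) := by
      funext s
      simp [xfun]
    rw [Matrix.of_apply, hx, iteratedDeriv_mul_eval_log _ _ ht, Matrix.diagonal_mul,
      Matrix.mul_apply, Polynomial.aeval_eq_sum_range' ((natDegree_eulerPoly i).trans_lt i.2),
      ← Fin.sum_univ_eq_sum_range (fun j => (eulerPoly i).coeff j •
        (Polynomial.derivative : Module.End ℝ (Polynomial ℝ)) ^ j),
      LinearMap.sum_apply, Polynomial.eval_finsetSum]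
    simp only [LinearMap.smul_apply, Polynomial.eval_smul, eval_iterate_derivative_X_pow,
      smul_eq_mul, hA, hB, Matrix.of_apply]
  have hdetA : A.det = 1 := by
    rw [Matrix.det_of_isLowerTriangular]
    · refine Finset.prod_eq_one fun i _ => ?_
      have h := (monic_eulerPoly i).coeff_natDegree
      rwa [natDegree_eulerPoly] at h
    · intro i j hij
      exact Polynomial.coeff_eq_zero_of_natDegree_lt ((natDegree_eulerPoly i).trans_lt hij)
  have hdetB : B.det = ∏ r ∈ Finset.range n, (Nat.factorial r : ℝ) := by
    rw [Matrix.det_of_isUpperTriangular, ← Fin.prod_univ_eq_prod_range]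
    · simp [hB, Nat.descFactorial_self]
    · intro i j hij
      have h : (j : ℕ) < i := hij
      simp [hB, Nat.descFactorial_of_lt h]
  obtain ⟨m, rfl⟩ := Nat.exists_eq_add_of_le' hn
  rw [hfactor, Matrix.det_mul, Matrix.det_mul, Matrix.det_diagonal, hdetA, hdetB, one_mul,
    Fin.prod_univ_eq_prod_range (fun i : ℕ => t ^ (1 - (i : ℤ))) (m + 3),
    prod_zpow_one_sub ht.ne', Nat.add_sub_cancel, div_eq_mul_inv, mul_comm]
end

section
/- Let 0 < a < b be real numbers. The tangent lines to the plane curve α(t) = (t, t·log t) at t = a and t = b intersect in a unique point, and the first coordinate of this intersection point equals the logarithmic mean L(a,b) = (b − a)/(log b − log a). -/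
open Real

/-- The tangent line to the curve `α(t) = (t, t·log t)` at parameter `c`:
the line through `α(c)` with direction `α'(c) = (1, log c + 1)`. -/
def tangentLine (c : ℝ) : Set (ℝ × ℝ) :=
  {p | ∃ s : ℝ, p = (c + s, c * Real.log c + s * (Real.log c + 1))}

theorem mem_tangentLine_iff {c : ℝ} {p : ℝ × ℝ} :
    p ∈ tangentLine c ↔ p.2 = p.1 * (Real.log c + 1) - c := by
  constructor
  · rintro ⟨s, rfl⟩
    ring
  · intro h
    refine ⟨p.1 - c, Prod.ext ?_ ?_⟩
    · ring
    · rw [h]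
      ring

theorem stmt_18 (a b : ℝ) (ha : 0 < a) (hab : a < b) :
    (∃! p : ℝ × ℝ, p ∈ tangentLine a ∧ p ∈ tangentLine b) ∧
      ∀ p : ℝ × ℝ, p ∈ tangentLine a → p ∈ tangentLine b →
        p.1 = (b - a) / (Real.log b - Real.log a) := by
  have hlog : Real.log b - Real.log a ≠ 0 := (sub_pos.2 (Real.log_lt_log ha hab)).ne'
  have fst_eq : ∀ p : ℝ × ℝ, p ∈ tangentLine a → p ∈ tangentLine b →
      p.1 = (b - a) / (Real.log b - Real.log a) := by
    intro p hpa hpb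
    rw [mem_tangentLine_iff] at hpa hpb
    rw [eq_div_iff hlog]
    linear_combination hpa - hpb
  refine ⟨⟨((b - a) / (Real.log b - Real.log a),
    (b - a) / (Real.log b - Real.log a) * (Real.log a + 1) - a), ⟨?_, ?_⟩, ?_⟩, fst_eq⟩
  · exact mem_tangentLine_iff.2 rfl
  · rw [mem_tangentLine_iff]
    linear_combination -(div_mul_cancel₀ (b - a) hlog)
  · rintro p ⟨hpa, hpb⟩
    have hp := fst_eq p hpa hpb
    refine Prod.ext hp ?_
    rw [mem_tangentLine_iff.1 hpa, hp]
end
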